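/- Let 0 < a < 2^{-1/6}, let N ≥ 2, and let (x*_1,…,x*_N) be a minimum-energy configuration for the cut-off Lennard-Jones potential V_a such that x*_1 = 0 and W⁺_a(1, x*) = max_{1≤i≤N} W⁺_a(i, x*). Then there exists an integer n ≥ 1 such that the number of indices i with |x*_i| ≤ 2n is at least (23/32) · W⁺_a(x*) · n³. (Equivalently, with Vol(S_n) = (32π/3)n³ and d(x*) = max_n #{i : |x*_i| ≤ 2n}/Vol(S_n), one has d(x*) ≥ (23/32)·W⁺_a(x*)/Vol(S_1).) -/

import Mathlib

open MeasureTheory Real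

noncomputable section

abbrev E3 := EuclideanSpace ℝ (Fin 3)

/-- Lennard-Jones potential -/
def VLJ (r : ℝ) : ℝ := 1 / r ^ 12 - 2 / r ^ 6

/-- cut-off Lennard-Jones potential -/
def Va (a r : ℝ) : ℝ := if a < r then VLJ r else VLJ a

/-- configurational energy of N particles -/
def pairEnergy (V : ℝ → ℝ) {N : ℕ} (x : Fin N → E3) : ℝ :=
  ∑ p ∈ Finset.univ.filter (fun p : Fin N × Fin N => p.1 < p.2), V ‖x p.1 - x p.2‖

/-- stability with constant B -/
def IsStableWith (V : ℝ → ℝ) (B : ℝ) : Prop :=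
  0 ≤ B ∧ ∀ (N : ℕ) (x : Fin N → E3), -(B * N) ≤ pairEnergy V x

/-- stability constant: infimum of admissible stability constants -/
def stabConst (V : ℝ → ℝ) : ℝ := sInf {B | IsStableWith V B}

def IsMinEnergy (V : ℝ → ℝ) {N : ℕ} (x : Fin N → E3) : Prop :=
  ∀ y : Fin N → E3, pairEnergy V x ≤ pairEnergy V y

def IsTempered (V : ℝ → ℝ) : Prop :=
  ∃ r₀ : ℝ, 0 ≤ r₀ ∧ IntegrableOn (fun x : E3 => |V ‖x‖|) {x | r₀ ≤ ‖x‖}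

open scoped Classical in
/-- n-th Mayer coefficient -/
def mayerCoeff (V : ℝ → ℝ) (β : ℝ) (Λ : Set E3) (n : ℕ) : ℝ :=
  (volume Λ).toReal⁻¹ * (n.factorial : ℝ)⁻¹ *
    ∫ x : Fin n → E3 in Set.univ.pi fun _ => Λ,
      ∑ g ∈ Finset.univ.filter (fun g : SimpleGraph (Fin n) => g.Connected),
        ∏ e ∈ Finset.univ.filter (fun e : Sym2 (Fin n) => e ∈ g.edgeSet),
          Sym2.lift ⟨fun i j => Real.exp (-β * V ‖x i - x j‖) - 1,
            fun i j => by simp only [norm_sub_rev (x i)]⟩ e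

/-- positive part of the interaction of particle `i` with the others:
sum over the particles at distance `< 2^{-1/6}` from particle `i` -/
def Wplus (a : ℝ) {N : ℕ} (x : Fin N → E3) (i : Fin N) : ℝ :=
  ∑ j ∈ Finset.univ.filter
      (fun j : Fin N => j ≠ i ∧ ‖x i - x j‖ < (2 : ℝ) ^ (-(1 : ℝ) / 6)),
    Va a ‖x i - x j‖

/-- maximal positive interaction `W⁺_a(x) = max_i W⁺_a(i,x)` -/
def WplusMax (a : ℝ) {N : ℕ} (x : Fin N → E3) : ℝ :=
  sSup {w : ℝ | ∃ i : Fin N, w = Wplus a x i}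

lemma neg_VLJ_le_one (r : ℝ) : -VLJ r ≤ 1 := by
  have h : VLJ r = (1 / r ^ 6 - 1) ^ 2 - 1 := by
    rw [VLJ, sub_sq, div_pow, ← pow_mul]
    ring
  nlinarith [sq_nonneg (1 / r ^ 6 - 1)]

lemma neg_Va_le_one (a r : ℝ) : -Va a r ≤ 1 := by
  unfold Va
  split_ifs <;> exact neg_VLJ_le_one _

lemma VLJ_nonpos_of_one_le {r : ℝ} (hr : 1 ≤ r) : VLJ r ≤ 0 := by
  have h1 : 1 ≤ r ^ 6 := one_le_pow₀ hr
  have h : VLJ r = (1 - 2 * r ^ 6) / r ^ 12 := by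
    unfold VLJ
    have : r ≠ 0 := by positivity
    field_simp
  rw [h]
  exact div_nonpos_of_nonpos_of_nonneg (by linarith) (by positivity)

lemma neg_VLJ_le {n : ℕ} (hn : 1 ≤ n) {r : ℝ} (hr : 2 * (n : ℝ) < r) :
    -VLJ r ≤ 1 / (32 * (n : ℝ) ^ 6) := by
  have hn' : (1 : ℝ) ≤ n := by exact_mod_cast hn
  have hr0 : 0 < r := by linarith
  have h1 : 2 / r ^ 6 ≤ 2 / (2 * (n : ℝ)) ^ 6 := by gcongr
  have h2 : 2 / (2 * (n : ℝ)) ^ 6 = 1 / (32 * (n : ℝ) ^ 6) := by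
    field_simp
    norm_num
  have h3 : 0 ≤ 1 / r ^ 12 := by positivity
  unfold VLJ
  linarith

/-- The energy splits into the interaction of the first particle with the rest and the
energy of the rest. -/
lemma pairEnergy_eq_first_add (V : ℝ → ℝ) {N : ℕ} (hN : 0 < N) (x : Fin N → E3) :
    pairEnergy V x = ∑ j ∈ Finset.univ.filter (fun j : Fin N => j ≠ ⟨0, hN⟩),
        V ‖x ⟨0, hN⟩ - x j‖ +
      ∑ p ∈ Finset.univ.filter (fun p : Fin N × Fin N => p.1 < p.2 ∧ p.1 ≠ ⟨0, hN⟩),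
        V ‖x p.1 - x p.2‖ := by
  unfold pairEnergy
  rw [← Finset.sum_filter_add_sum_filter_not _ (fun p : Fin N × Fin N => p.1 = ⟨0, hN⟩)]
  simp only [Finset.filter_filter]
  congr 1
  refine Finset.sum_nbij' (fun p => p.2) (fun j => (⟨0, hN⟩, j)) ?_ ?_ ?_ ?_ ?_
  · rintro ⟨i, j⟩ h
    simp only [Finset.mem_filter, Finset.mem_univ, true_and] at h ⊢
    exact h.2 ▸ h.1.ne'
  · intro j h
    simp only [Finset.mem_filter, Finset.mem_univ, true_and, and_true] at h ⊢
    rw [Fin.lt_def]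
    exact Nat.pos_of_ne_zero fun h' => h (Fin.ext h')
  · rintro ⟨i, j⟩ h
    simp only [Finset.mem_filter, Finset.mem_univ, true_and] at h ⊢
    rw [h.2]
  · intro j _
    rfl
  · rintro ⟨i, j⟩ h
    simp only [Finset.mem_filter, Finset.mem_univ, true_and] at h ⊢
    rw [h.2]

/-- In a minimum-energy configuration the first particle has nonpositive interaction energy
with the others, since it could otherwise be moved far away. -/
lemma IsMinEnergy.first_interaction_nonpos {V : ℝ → ℝ} {R : ℝ} (hV : ∀ r, R ≤ r → V r ≤ 0)
    {N : ℕ} (hN : 0 < N) {x : Fin N → E3} (hx : IsMinEnergy V x) :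
    ∑ j ∈ Finset.univ.filter (fun j : Fin N => j ≠ ⟨0, hN⟩), V ‖x ⟨0, hN⟩ - x j‖ ≤ 0 := by
  obtain ⟨q, hq⟩ := NormedSpace.exists_lt_norm ℝ E3 (R + ∑ j, ‖x j‖)
  have hmin := hx (Function.update x ⟨0, hN⟩ q)
  rw [pairEnergy_eq_first_add V hN, pairEnergy_eq_first_add V hN] at hmin
  have hrest : ∑ p ∈ Finset.univ.filter
        (fun p : Fin N × Fin N => p.1 < p.2 ∧ p.1 ≠ ⟨0, hN⟩),
        V ‖Function.update x ⟨0, hN⟩ q p.1 - Function.update x ⟨0, hN⟩ q p.2‖ =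
      ∑ p ∈ Finset.univ.filter (fun p : Fin N × Fin N => p.1 < p.2 ∧ p.1 ≠ ⟨0, hN⟩),
        V ‖x p.1 - x p.2‖ := by
    refine Finset.sum_congr rfl ?_
    rintro ⟨i, j⟩ h
    simp only [Finset.mem_filter, Finset.mem_univ, true_and] at h
    have hj : j ≠ ⟨0, hN⟩ := by
      rintro rfl
      exact absurd h.1 (Nat.not_lt_zero _)
    rw [Function.update_of_ne h.2, Function.update_of_ne hj]
  have hfirst : ∑ j ∈ Finset.univ.filter (fun j : Fin N => j ≠ ⟨0, hN⟩),
      V ‖Function.update x ⟨0, hN⟩ q ⟨0, hN⟩ - Function.update x ⟨0, hN⟩ q j‖ ≤ 0 := by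
    refine Finset.sum_nonpos fun j h => ?_
    rw [Function.update_self, Function.update_of_ne (Finset.mem_filter.1 h).2]
    apply hV
    have h1 : ‖x j‖ ≤ ∑ j, ‖x j‖ :=
      Finset.single_le_sum (f := fun j => ‖x j‖) (fun _ _ => norm_nonneg _) (Finset.mem_univ j)
    linarith [norm_sub_norm_le q (x j)]
  linarith

/-- The positive interaction of the first particle is at most the total attraction it feels. -/
lemma Wplus_le_sum_attraction {a : ℝ} (ha' : a < 1) {N : ℕ} (hN : 0 < N) {x : Fin N → E3}
    (hx : IsMinEnergy (Va a) x) :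
    Wplus a x ⟨0, hN⟩ ≤ ∑ j, max 0 (-Va a ‖x ⟨0, hN⟩ - x j‖) := by
  have h := IsMinEnergy.first_interaction_nonpos (R := 1) (fun r hr => by
    rw [Va, if_pos (ha'.trans_le hr)]
    exact VLJ_nonpos_of_one_le hr) hN hx
  have hW : Wplus a x ⟨0, hN⟩ ≤
      ∑ j ∈ Finset.univ.filter (fun j : Fin N => j ≠ ⟨0, hN⟩),
        (Va a ‖x ⟨0, hN⟩ - x j‖ + max 0 (-Va a ‖x ⟨0, hN⟩ - x j‖)) := by
    rw [Wplus, ← Finset.filter_filter, Finset.sum_filter]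
    refine Finset.sum_le_sum fun j _ => ?_
    split_ifs
    · linarith [le_max_left 0 (-Va a ‖x ⟨0, hN⟩ - x j‖)]
    · linarith [le_max_right 0 (-Va a ‖x ⟨0, hN⟩ - x j‖)]
  rw [Finset.sum_add_distrib] at hW
  have hsub : ∑ j ∈ Finset.univ.filter (fun j : Fin N => j ≠ ⟨0, hN⟩),
        max 0 (-Va a ‖x ⟨0, hN⟩ - x j‖) ≤ ∑ j, max 0 (-Va a ‖x ⟨0, hN⟩ - x j‖) :=
    Finset.sum_le_sum_of_subset_of_nonneg (Finset.filter_subset _ _)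
      fun _ _ _ => le_max_left _ _
  linarith

lemma shell_weight_step {m : ℝ} (hm : 1 ≤ m) :
    1 / (32 * m ^ 6) * ((m + 1) ^ 3 - m ^ 3) ≤ 1 / (3 * m ^ 2) - 1 / (3 * (m + 1) ^ 2) := by
  have h0 : 0 < m := by linarith
  have key : 3 * (3 * m ^ 2 + 3 * m + 1) * (m + 1) ^ 2 ≤ 32 * m ^ 4 * (2 * m + 1) := by
    obtain ⟨t, rfl⟩ : ∃ t, m = t + 1 := ⟨m - 1, by ring⟩
    have ht : 0 ≤ t := by linarith
    rw [← sub_nonneg]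
    ring_nf
    positivity
  have h1 : 1 / (32 * m ^ 6) * ((m + 1) ^ 3 - m ^ 3) =
      3 * (3 * m ^ 2 + 3 * m + 1) * (m + 1) ^ 2 / (96 * m ^ 6 * (m + 1) ^ 2) := by
    field_simp
    ring
  have h2 : 1 / (3 * m ^ 2) - 1 / (3 * (m + 1) ^ 2) =
      32 * m ^ 4 * (2 * m + 1) / (96 * m ^ 6 * (m + 1) ^ 2) := by
    field_simp
    ring
  rw [h1, h2]
  gcongr

/-- Summation by parts over the shells `2n < r ≤ 2(n+1)`: cubic growth of the number of
points controls the sum of weights that decay like `1 / (32 n⁶)`. -/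
lemma sum_weights_le {ι : Type*} [Fintype ι] (r u : ι → ℝ) {C : ℝ} (hu1 : ∀ i, u i ≤ 1)
    (hu : ∀ n : ℕ, 1 ≤ n → ∀ i, 2 * (n : ℝ) < r i → u i ≤ 1 / (32 * (n : ℝ) ^ 6))
    (hK : ∀ n : ℕ, 1 ≤ n →
      ((Finset.univ.filter fun i => r i ≤ 2 * (n : ℝ)).card : ℝ) ≤ C * (n : ℝ) ^ 3)
    {n : ℕ} (hn : 1 ≤ n) :
    ∑ i ∈ Finset.univ.filter (fun i => r i ≤ 2 * (n : ℝ)), (u i - 1 / (32 * (n : ℝ) ^ 6)) ≤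
      C * (4 / 3 - 1 / (3 * (n : ℝ) ^ 2) - 1 / (32 * (n : ℝ) ^ 6) * (n : ℝ) ^ 3) := by
  classical
  have hC : 0 ≤ C := by simpa using (Nat.cast_nonneg _).trans (hK 1 le_rfl)
  induction n, hn using Nat.le_induction with
  | base =>
    have h1 := hK 1 le_rfl
    have h2 : ∑ i ∈ Finset.univ.filter (fun i => r i ≤ 2 * ((1 : ℕ) : ℝ)),
        (u i - 1 / (32 * ((1 : ℕ) : ℝ) ^ 6)) ≤
        (Finset.univ.filter fun i => r i ≤ 2 * ((1 : ℕ) : ℝ)).card • (31 / 32 : ℝ) := by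
      refine Finset.sum_le_card_nsmul _ _ _ fun i _ => ?_
      norm_num
      linarith [hu1 i]
    rw [nsmul_eq_mul] at h2
    refine h2.trans ?_
    norm_num at h1 ⊢
    linarith
  | succ n hn ih =>
    have hn' : (1 : ℝ) ≤ n := by exact_mod_cast hn
    set e : ℝ := 1 / (32 * (n : ℝ) ^ 6) with he
    set e' : ℝ := 1 / (32 * ((n + 1 : ℕ) : ℝ) ^ 6) with he'
    have hee : e' ≤ e := by
      rw [he, he']
      gcongr
      simp
    have hsub : Finset.univ.filter (fun i => r i ≤ 2 * (n : ℝ)) ⊆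
        Finset.univ.filter (fun i => r i ≤ 2 * ((n + 1 : ℕ) : ℝ)) := by
      refine Finset.monotone_filter_right _ fun i _ h => h.trans ?_
      push_cast
      linarith
    have hshell : ∑ i ∈ Finset.univ.filter (fun i => r i ≤ 2 * ((n + 1 : ℕ) : ℝ)), (u i - e) ≤
        ∑ i ∈ Finset.univ.filter (fun i => r i ≤ 2 * (n : ℝ)), (u i - e) := by
      rw [← Finset.sum_sdiff hsub]
      have : ∑ i ∈ Finset.univ.filter (fun i => r i ≤ 2 * ((n + 1 : ℕ) : ℝ)) \
          Finset.univ.filter (fun i => r i ≤ 2 * (n : ℝ)), (u i - e) ≤ 0 := by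
        refine Finset.sum_nonpos fun i hi => ?_
        simp only [Finset.mem_sdiff, Finset.mem_filter, Finset.mem_univ, true_and, not_le] at hi
        linarith [hu n hn i hi.2]
      linarith
    have hsplit : ∑ i ∈ Finset.univ.filter (fun i => r i ≤ 2 * ((n + 1 : ℕ) : ℝ)), (u i - e') =
        ∑ i ∈ Finset.univ.filter (fun i => r i ≤ 2 * ((n + 1 : ℕ) : ℝ)), (u i - e) +
        (Finset.univ.filter fun i => r i ≤ 2 * ((n + 1 : ℕ) : ℝ)).card * (e - e') := by
      rw [← nsmul_eq_mul, ← Finset.sum_const, ← Finset.sum_add_distrib]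
      exact Finset.sum_congr rfl fun _ _ => by ring
    have hcard := mul_le_mul_of_nonneg_right (hK (n + 1) (by omega)) (sub_nonneg.2 hee)
    have hstep := mul_le_mul_of_nonneg_left (shell_weight_step hn') hC
    rw [← he] at hstep
    rw [hsplit]
    push_cast at hcard hshell ⊢
    linear_combination hcard + hshell + ih + hstep

/-- in a minimum-energy configuration with the first particle at the
origin realizing the maximal positive interaction, some ball of radius `2n`
centered at the origin contains at least `(23/32)·W⁺_a(x*)·n³` particles. -/
theorem stmt11 (a : ℝ) (ha : 0 < a) (ha' : a < (2 : ℝ) ^ (-(1 : ℝ) / 6))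
    (N : ℕ) (hN : 1 ≤ N) (x : Fin N → E3) (hx : IsMinEnergy (Va a) x)
    (h0 : x ⟨0, by omega⟩ = 0)
    (hmax : Wplus a x ⟨0, by omega⟩ = WplusMax a x) :
    ∃ n : ℕ, 1 ≤ n ∧
      (23 / 32 : ℝ) * WplusMax a x * (n : ℝ) ^ 3 ≤
        (Finset.univ.filter (fun i : Fin N => ‖x i‖ ≤ 2 * (n : ℝ))).card := by
  have hs : (2 : ℝ) ^ (-(1 : ℝ) / 6) ≤ 1 :=
    Real.rpow_le_one_of_one_le_of_nonpos (by norm_num) (by norm_num)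
  have ha1 : a < 1 := ha'.trans_le hs
  by_contra! hcon
  rw [← hmax] at hcon
  set W := Wplus a x ⟨0, by omega⟩
  have hWpos : 0 < W := by
    have h := (Nat.cast_nonneg _).trans_lt (hcon 1 le_rfl)
    norm_num at h
    linarith
  have hle := Wplus_le_sum_attraction ha1 hN hx
  rw [h0] at hle
  simp only [zero_sub, norm_neg] at hle
  have hsum := fun n hn => sum_weights_le (fun i => ‖x i‖) (fun i => max 0 (-Va a ‖x i‖))
    (C := 23 / 32 * W) (fun i => max_le zero_le_one (neg_Va_le_one _ _))
    (fun n hn i hi => by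
      have hn' : (1 : ℝ) ≤ n := by exact_mod_cast hn
      have hai : a < ‖x i‖ := by linarith
      rw [Va, if_pos hai]
      exact max_le (by positivity) (neg_VLJ_le hn hi))
    (fun n hn => (hcon n hn).le) (n := n) hn
  obtain ⟨m, hm⟩ := exists_nat_ge (1 + ∑ j, ‖x j‖)
  have hm1 : (1 : ℝ) ≤ m := by
    linarith [Finset.sum_nonneg fun j (_ : j ∈ Finset.univ) => norm_nonneg (x j)]
  have hmN : 1 ≤ m := by exact_mod_cast hm1
  have hall : Finset.univ.filter (fun i : Fin N => ‖x i‖ ≤ 2 * (m : ℝ)) = Finset.univ := by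
    refine Finset.filter_true_of_mem fun i hi => ?_
    have h1 := Finset.single_le_sum (f := fun j => ‖x j‖) (fun _ _ => norm_nonneg _) hi
    linarith
  have hcard := (hcon m hmN).le
  have hfin := hsum m hmN
  rw [hall] at hcard hfin
  rw [Finset.sum_sub_distrib, Finset.sum_const, nsmul_eq_mul] at hfin
  have he : 0 ≤ 1 / (32 * (m : ℝ) ^ 6) := by positivity
  have hq : 0 ≤ 1 / (3 * (m : ℝ) ^ 2) := by positivity
  have h1 := mul_le_mul_of_nonneg_right hcard he
  have h2 := mul_nonneg hWpos.le hq
  nlinarith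

end
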